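/- arXiv:math/0103058 — 3 statements merged into one kernel-verified Lean document; each statement's English description precedes it below -/
import Mathlib

section
/- Let k ≥ 1 be an integer. For every complex number w with Re w < 1 and every real t > 0, the limit defining φ_{w,k}(t) exists and equals lim_{Λ→∞} (1/(πt)) ∫₁^Λ (k + w·log u)·(log u)^{k−1}·u^{w−2}·sin(2πtu) du; for each fixed t > 0 the function w ↦ φ_{w,k}(t) is holomorphic on the half-plane Re w < 1; and for every compact subset Ω of {w : Re w < 1} there is a constant C with |φ_{w,k}(t)| ≤ C/t for all w ∈ Ω and all t ≥ 1. -/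
open MeasureTheory Set Filter intervalIntegral

/-- The function `log u ^ k * sin (2πtu)` on `(1, ∞)`, extended by zero. -/
noncomputable def logSin (k : ℕ) (t : ℝ) : ℝ → ℂ :=
  (Ioi (1 : ℝ)).indicator
    fun u => ((Real.log u : ℝ) : ℂ) ^ k * ((Real.sin (2 * Real.pi * t * u) : ℝ) : ℂ)

lemma logSin_of_one_lt {k : ℕ} {t u : ℝ} (hu : 1 < u) :
    logSin k t u = ((Real.log u : ℝ) : ℂ) ^ k * ((Real.sin (2 * Real.pi * t * u) : ℝ) : ℂ) :=
  indicator_of_mem (mem_Ioi.2 hu) _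

lemma logSin_of_le_one {k : ℕ} {t u : ℝ} (hu : u ≤ 1) : logSin k t u = 0 :=
  indicator_of_notMem (notMem_Ioi.2 hu) _

lemma exists_log_pow_le (k : ℕ) {ε : ℝ} (hε : 0 < ε) :
    ∃ C : ℝ, 0 ≤ C ∧ ∀ u : ℝ, 1 ≤ u → Real.log u ^ k ≤ C * u ^ ε := by
  set η : ℝ := ε / (k + 1)
  have hη : 0 < η := by positivity
  refine ⟨(η ^ k)⁻¹, by positivity, fun u hu => ?_⟩
  have hu0 : 0 ≤ u := by linarith
  have h1 : Real.log u ≤ u ^ η / η := Real.log_le_rpow_div hu0 hη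
  calc Real.log u ^ k ≤ (u ^ η / η) ^ k := pow_le_pow_left₀ (Real.log_nonneg hu) h1 k
    _ = (η ^ k)⁻¹ * u ^ (η * k) := by
        rw [div_pow, ← Real.rpow_natCast (u ^ η), ← Real.rpow_mul hu0]; ring
    _ ≤ (η ^ k)⁻¹ * u ^ ε := by
        gcongr
        calc η * k ≤ η * (k + 1) := by gcongr; linarith
          _ = ε := by simp only [η]; field_simp

lemma norm_logSin_le {k : ℕ} {t u : ℝ} (hu : 1 ≤ u) : ‖logSin k t u‖ ≤ Real.log u ^ k := by
  have h0 : 0 ≤ Real.log u := Real.log_nonneg hu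
  rcases hu.eq_or_lt with rfl | h
  · rw [logSin_of_le_one le_rfl, norm_zero]; positivity
  · rw [logSin_of_one_lt h, norm_mul, norm_pow, Complex.norm_real, Complex.norm_real,
      Real.norm_of_nonneg h0]
    exact mul_le_of_le_one_right (by positivity) (Real.abs_sin_le_one _)

lemma logSin_isBigO_atTop (k : ℕ) (t : ℝ) {ε : ℝ} (hε : 0 < ε) :
    logSin k t =O[atTop] fun u : ℝ => u ^ ε := by
  obtain ⟨C, -, hC⟩ := exists_log_pow_le k hε
  refine Asymptotics.IsBigO.of_bound C ?_
  filter_upwards [eventually_ge_atTop 1] with u hu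
  have hu0 : 0 ≤ u := by linarith
  rw [Real.norm_of_nonneg (Real.rpow_nonneg hu0 ε)]
  exact (norm_logSin_le hu).trans (hC u hu)

lemma logSin_isBigO_zero (k : ℕ) (t b : ℝ) :
    logSin k t =O[nhdsWithin 0 (Ioi 0)] fun u : ℝ => u ^ (-b) := by
  refine Asymptotics.IsBigO.of_bound 0 ?_
  filter_upwards [mem_nhdsWithin_of_mem_nhds (Iic_mem_nhds one_pos)] with u hu
  simp [logSin_of_le_one hu]

lemma measurable_logSin (k : ℕ) (t : ℝ) : Measurable (logSin k t) := by
  refine Measurable.indicator ?_ measurableSet_Ioi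
  fun_prop

lemma locallyIntegrableOn_logSin (k : ℕ) (t : ℝ) : LocallyIntegrableOn (logSin k t) (Ioi 0) := by
  obtain ⟨C, hC0, hC⟩ := exists_log_pow_le k one_pos
  refine LocallyIntegrable.locallyIntegrableOn ?_ _
  refine ((show Continuous fun u : ℝ => C * |u| by fun_prop).locallyIntegrable
    (μ := volume)).mono
    (measurable_logSin k t).aestronglyMeasurable (Eventually.of_forall fun u => ?_)
  rcases le_or_gt u 1 with h | h
  · rw [logSin_of_le_one h, norm_zero]; positivity
  · have := hC u h.le
    rw [Real.rpow_one] at this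
    rw [norm_mul, Real.norm_of_nonneg hC0, Real.norm_eq_abs, abs_abs, abs_of_pos (by linarith)]
    exact (norm_logSin_le h.le).trans this

lemma mellinConvergent_logSin (k : ℕ) (t : ℝ) {s : ℂ} (hs : s.re < 0) :
    MellinConvergent (logSin k t) s := by
  refine mellinConvergent_of_isBigO_rpow (a := s.re / 2) (b := s.re - 1)
    (locallyIntegrableOn_logSin k t) ?_ (by linarith) (logSin_isBigO_zero k t _) (by linarith)
  exact logSin_isBigO_atTop k t (by linarith)

lemma differentiableAt_mellin_logSin (k : ℕ) (t : ℝ) {s : ℂ} (hs : s.re < 0) :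
    DifferentiableAt ℂ (mellin (logSin k t)) s := by
  refine mellin_differentiableAt_of_isBigO_rpow (a := s.re / 2) (b := s.re - 1)
    (locallyIntegrableOn_logSin k t) ?_ (by linarith) (logSin_isBigO_zero k t _) (by linarith)
  exact logSin_isBigO_atTop k t (by linarith)

lemma exists_norm_mellin_logSin_le (k : ℕ) {σ : ℝ} (hσ : σ < 0) :
    ∃ C : ℝ, 0 ≤ C ∧ ∀ t : ℝ, ∀ s : ℂ, s.re ≤ σ → ‖mellin (logSin k t) s‖ ≤ C := by
  obtain ⟨C, hC0, hC⟩ := exists_log_pow_le k (show 0 < -σ / 2 by linarith)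
  set g : ℝ → ℝ := (Ioi (1 : ℝ)).indicator fun u => C * u ^ (σ / 2 - 1)
  have hg : IntegrableOn g (Ioi 0) := by
    refine Integrable.integrableOn ?_
    rw [integrable_indicator_iff measurableSet_Ioi]
    exact (integrableOn_Ioi_rpow_of_lt (by linarith) one_pos).const_mul C
  have hb : ∀ t : ℝ, ∀ s : ℂ, s.re ≤ σ → ‖mellin (logSin k t) s‖ ≤ ∫ u in Ioi 0, g u := by
    intro t s hs
    refine norm_integral_le_of_norm_le hg ?_
    filter_upwards [ae_restrict_mem measurableSet_Ioi] with u hu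
    rcases le_or_gt u 1 with h | h
    · simp [logSin_of_le_one h, g, h]
    · have hu0 : 0 < u := hu
      rw [norm_smul, Complex.norm_cpow_eq_rpow_re_of_pos hu0]
      simp only [g, indicator_of_mem (mem_Ioi.2 h)]
      calc u ^ (s - 1).re * ‖logSin k t u‖ ≤ u ^ (σ - 1) * (C * u ^ (-σ / 2)) := by
            gcongr
            · exact h.le
            · simpa using hs
            · exact (norm_logSin_le h.le).trans (hC u h.le)
        _ = C * (u ^ (σ - 1) * u ^ (-σ / 2)) := by ring
        _ = C * u ^ (σ / 2 - 1) := by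
            rw [← Real.rpow_add hu0]; congr 2; ring
  exact ⟨∫ u in Ioi 0, g u, (norm_nonneg _).trans (hb 0 σ (by simp)), hb⟩

lemma integrableOn_and_integral_eq_mellin_logSin (k : ℕ) (t : ℝ) {w : ℂ} (hw : w.re < 1) :
    IntegrableOn (fun u : ℝ => ((Real.log u : ℝ) : ℂ) ^ k * (u : ℂ) ^ (w - 2)
        * ((Real.sin (2 * Real.pi * t * u) : ℝ) : ℂ)) (Ioi 1) ∧
      ∫ u in Ioi (1 : ℝ), ((Real.log u : ℝ) : ℂ) ^ k * (u : ℂ) ^ (w - 2)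
        * ((Real.sin (2 * Real.pi * t * u) : ℝ) : ℂ) = mellin (logSin k t) (w - 1) := by
  have hEq : EqOn (fun u : ℝ => (u : ℂ) ^ (w - 1 - 1) • logSin k t u)
      (fun u : ℝ => ((Real.log u : ℝ) : ℂ) ^ k * (u : ℂ) ^ (w - 2)
        * ((Real.sin (2 * Real.pi * t * u) : ℝ) : ℂ)) (Ioi 1) := by
    intro u hu
    simp only [logSin_of_one_lt (mem_Ioi.1 hu), smul_eq_mul]
    rw [show w - 1 - 1 = w - 2 by ring]
    ring
  have hsub : Ioi (1 : ℝ) ⊆ Ioi 0 := Ioi_subset_Ioi zero_le_one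
  constructor
  · have := mellinConvergent_logSin k t (s := w - 1) (by simpa using hw)
    exact (this.mono_set hsub).congr_fun hEq measurableSet_Ioi
  · rw [← setIntegral_congr_fun measurableSet_Ioi hEq, mellin]
    refine (setIntegral_eq_of_subset_of_forall_sdiff_eq_zero measurableSet_Ioi hsub ?_).symm
    intro u hu
    rw [logSin_of_le_one (not_lt.1 hu.2), smul_zero]

/-- The integrand obtained from `logSin` by an integration by parts and inversion. -/
noncomputable def logSinKernel (n : ℕ) (t : ℝ) (w : ℂ) (u : ℝ) : ℂ :=
  (((n + 1 : ℕ) : ℂ) + w * (Real.log u : ℂ)) * ((Real.log u : ℝ) : ℂ) ^ n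
    * (u : ℂ) ^ (w - 2) * (Real.sin (2 * Real.pi * t * u) : ℂ)

lemma tendsto_integral_logSinKernel (n : ℕ) (t : ℝ) {w : ℂ} (hw : w.re < 1) :
    Tendsto (fun Λ : ℝ => ∫ u in (1 : ℝ)..Λ, logSinKernel n t w u) atTop
      (nhds (((n + 1 : ℕ) : ℂ) * mellin (logSin n t) (w - 1)
        + w * mellin (logSin (n + 1) t) (w - 1))) := by
  obtain ⟨hi, he⟩ := integrableOn_and_integral_eq_mellin_logSin n t hw
  obtain ⟨hi', he'⟩ := integrableOn_and_integral_eq_mellin_logSin (n + 1) t hw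
  have hsplit : logSinKernel n t w = fun u : ℝ =>
      ((n + 1 : ℕ) : ℂ) * (((Real.log u : ℝ) : ℂ) ^ n * (u : ℂ) ^ (w - 2)
        * ((Real.sin (2 * Real.pi * t * u) : ℝ) : ℂ))
      + w * (((Real.log u : ℝ) : ℂ) ^ (n + 1) * (u : ℂ) ^ (w - 2)
        * ((Real.sin (2 * Real.pi * t * u) : ℝ) : ℂ)) := by
    funext u
    rw [logSinKernel]
    ring
  rw [← he, ← he', ← MeasureTheory.integral_const_mul, ← MeasureTheory.integral_const_mul,
    ← MeasureTheory.integral_add (hi.const_mul _) (hi'.const_mul _), hsplit]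
  exact intervalIntegral_tendsto_integral_Ioi 1 ((hi.const_mul _).add (hi'.const_mul _)) tendsto_id

lemma continuousAt_logSinKernel (n : ℕ) (t : ℝ) (w : ℂ) {u : ℝ} (hu : 0 < u) :
    ContinuousAt (logSinKernel n t w) u := by
  have h1 : ContinuousAt (fun u : ℝ => ((Real.log u : ℝ) : ℂ)) u :=
    Complex.continuous_ofReal.continuousAt.comp (Real.continuousAt_log hu.ne')
  have h2 : ContinuousAt (fun u : ℝ => (u : ℂ) ^ (w - 2)) u :=
    Complex.continuousAt_ofReal_cpow_const _ _ (Or.inr hu.ne')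
  have h3 : ContinuousAt (fun u : ℝ => ((Real.sin (2 * Real.pi * t * u) : ℝ) : ℂ)) u := by
    fun_prop
  exact (((continuousAt_const.add (continuousAt_const.mul h1)).mul (h1.pow n)).mul h2).mul h3

lemma tendsto_log_pow_mul_cpow_mul_sin (k : ℕ) (t : ℝ) {w : ℂ} (hw : w.re < 1) :
    Tendsto (fun u : ℝ => ((Real.log u : ℝ) : ℂ) ^ k * (u : ℂ) ^ (w - 1)
      * ((Real.sin (2 * Real.pi * t * u) : ℝ) : ℂ)) atTop (nhds 0) := by
  obtain ⟨C, -, hC⟩ := exists_log_pow_le k (show 0 < (1 - w.re) / 2 by linarith)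
  have hlim : Tendsto (fun u : ℝ => C * u ^ (-((1 - w.re) / 2))) atTop (nhds 0) := by
    simpa using (tendsto_rpow_neg_atTop (show 0 < (1 - w.re) / 2 by linarith)).const_mul C
  refine squeeze_zero_norm' ?_ hlim
  filter_upwards [eventually_gt_atTop 1] with u hu
  have hu0 : 0 < u := by linarith
  have h := (norm_logSin_le (k := k) (t := t) hu.le).trans (hC u hu.le)
  rw [logSin_of_one_lt hu] at h
  calc _ = ‖((Real.log u : ℝ) : ℂ) ^ k * ((Real.sin (2 * Real.pi * t * u) : ℝ) : ℂ)‖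
        * u ^ (w.re - 1) := by
        rw [norm_mul, norm_mul, norm_mul, Complex.norm_cpow_eq_rpow_re_of_pos hu0]
        simp only [Complex.sub_re, Complex.one_re]
        ring
    _ ≤ C * u ^ ((1 - w.re) / 2) * u ^ (w.re - 1) := by gcongr
    _ = C * u ^ (-((1 - w.re) / 2)) := by
        rw [mul_assoc, ← Real.rpow_add hu0]; congr 2; ring

lemma hasDerivAt_mul_sin_div {t : ℝ} (ht : 0 < t) {v : ℝ} (hv : 0 < v) :
    HasDerivAt (fun x : ℝ => x * Real.sin (2 * Real.pi * t / x) / (Real.pi * t))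
      ((Real.sin (2 * Real.pi * t / v)
        - 2 * Real.pi * t / v * Real.cos (2 * Real.pi * t / v)) / (Real.pi * t)) v := by
  have h1 : HasDerivAt (fun x : ℝ => 2 * Real.pi * t / x) (-(2 * Real.pi * t) / v ^ 2) v := by
    simpa using (hasDerivAt_const v (2 * Real.pi * t)).fun_div (hasDerivAt_id v) hv.ne'
  refine HasDerivAt.congr_deriv (((hasDerivAt_id v).fun_mul h1.sin).div_const (Real.pi * t)) ?_
  simp only [id]
  field_simp
  ring

lemma hasDerivAt_sub_integral_logSinKernel (n : ℕ) (t : ℝ) (w : ℂ) {u : ℝ} (hu : 0 < u) :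
    HasDerivAt (fun x : ℝ => ((Real.log x : ℝ) : ℂ) ^ (n + 1) * (x : ℂ) ^ (w - 1)
        * ((Real.sin (2 * Real.pi * t * x) : ℝ) : ℂ) - ∫ y in (1 : ℝ)..x, logSinKernel n t w y)
      (((Real.log u : ℝ) : ℂ) ^ (n + 1) * (u : ℂ) ^ (w - 2)
        * ((2 * Real.pi * t * u * Real.cos (2 * Real.pi * t * u)
          - Real.sin (2 * Real.pi * t * u) : ℝ) : ℂ)) u := by
  have hu' : (u : ℂ) ≠ 0 := Complex.ofReal_ne_zero.2 hu.ne'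
  have hlog : HasDerivAt (fun x : ℝ => ((Real.log x : ℝ) : ℂ)) ((u⁻¹ : ℝ) : ℂ) u :=
    (Real.hasDerivAt_log hu.ne').ofReal_comp
  have hcpow : HasDerivAt (fun x : ℝ => (x : ℂ) ^ (w - 1)) ((w - 1) * (u : ℂ) ^ (w - 2)) u := by
    have h := (hasDerivAt_id (u : ℂ)).cpow_const (c := w - 1)
      (Complex.ofReal_mem_slitPlane.2 hu)
    have h' := h.comp_ofReal
    simp only [id, mul_one] at h'
    rwa [show w - 1 - 1 = w - 2 by ring] at h'
  have hsin : HasDerivAt (fun x : ℝ => ((Real.sin (2 * Real.pi * t * x) : ℝ) : ℂ))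
      ((Real.cos (2 * Real.pi * t * u) * (2 * Real.pi * t) : ℝ) : ℂ) u := by
    have h := ((hasDerivAt_id u).const_mul (2 * Real.pi * t)).sin
    simp only [id, mul_one] at h
    exact h.ofReal_comp
  have hint : HasDerivAt (fun x : ℝ => ∫ y in (1 : ℝ)..x, logSinKernel n t w y)
      (logSinKernel n t w u) u := by
    have hcont : ContinuousOn (logSinKernel n t w) (Ioi 0) := fun x hx =>
      (continuousAt_logSinKernel n t w hx).continuousWithinAt
    refine integral_hasDerivAt_right ?_
      (hcont.stronglyMeasurableAtFilter isOpen_Ioi u hu) (continuousAt_logSinKernel n t w hu)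
    exact (hcont.mono fun x hx => (lt_min one_pos hu).trans_le hx.1).intervalIntegrable
  have hsucc : (u : ℂ) ^ (w - 1) = (u : ℂ) ^ (w - 2) * u := by
    rw [show w - 1 = w - 2 + 1 by ring, Complex.cpow_add _ _ hu', Complex.cpow_one]
  refine ((((hlog.fun_pow (n + 1)).fun_mul hcpow).fun_mul hsin).fun_sub hint).congr_deriv ?_
  rw [logSinKernel, hsucc]
  push_cast
  field_simp
  ring

lemma integral_eq_integral_logSinKernel_sub (n : ℕ) {t : ℝ} (ht : 0 < t) (w : ℂ) {δ : ℝ}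
    (hδ : 0 < δ) :
    ∫ v in δ..1, ((Real.log (1 / v) : ℝ) : ℂ) ^ (n + 1) * (v : ℂ) ^ (-w)
        * ((deriv (fun x : ℝ => x * Real.sin (2 * Real.pi * t / x) / (Real.pi * t)) v : ℝ) : ℂ)
      = (1 / ((Real.pi : ℂ) * t)) * (∫ u in (1 : ℝ)..δ⁻¹, logSinKernel n t w u)
        - (1 / ((Real.pi : ℂ) * t)) * (((Real.log δ⁻¹ : ℝ) : ℂ) ^ (n + 1)
          * ((δ⁻¹ : ℝ) : ℂ) ^ (w - 1) * ((Real.sin (2 * Real.pi * t * δ⁻¹) : ℝ) : ℂ)) := by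
  have hpos : ∀ v ∈ uIcc δ 1, 0 < v := fun v hv => (lt_min hδ one_pos).trans_le hv.1
  set f : ℝ → ℂ := fun v => ((Real.log (1 / v) : ℝ) : ℂ) ^ (n + 1) * (v : ℂ) ^ (-w)
        * (((Real.sin (2 * Real.pi * t / v)
          - 2 * Real.pi * t / v * Real.cos (2 * Real.pi * t / v)) / (Real.pi * t) : ℝ) : ℂ) with hf
  have hcont : ContinuousOn f (uIcc δ 1) := by
    intro v hv
    have hv0 := (hpos v hv).ne'
    have hcpow : ContinuousAt (fun v : ℝ => (v : ℂ) ^ (-w)) v :=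
      Complex.continuousAt_ofReal_cpow_const _ _ (Or.inr hv0)
    have hinv : ContinuousAt (fun v : ℝ => 1 / v) v := by fun_prop (disch := assumption)
    have hlog : ContinuousAt (fun v : ℝ => Real.log (1 / v)) v :=
      hinv.log (one_div_ne_zero hv0)
    have htrig : ContinuousAt (fun v : ℝ => (Real.sin (2 * Real.pi * t / v)
        - 2 * Real.pi * t / v * Real.cos (2 * Real.pi * t / v)) / (Real.pi * t)) v := by
      fun_prop (disch := first | assumption | positivity)
    exact ContinuousAt.continuousWithinAt
      (((hlog.ofReal.pow (n + 1)).mul hcpow).mul htrig.ofReal)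
  set G : ℝ → ℂ := fun x => ((Real.log x : ℝ) : ℂ) ^ (n + 1) * (x : ℂ) ^ (w - 1)
        * ((Real.sin (2 * Real.pi * t * x) : ℝ) : ℂ) - ∫ y in (1 : ℝ)..x, logSinKernel n t w y
    with hG
  have hderiv : ∀ v ∈ uIcc δ 1,
      HasDerivAt (fun v : ℝ => (1 / ((Real.pi : ℂ) * t)) * G v⁻¹) (f v) v := by
    intro v hv
    have hv0 := hpos v hv
    have hvc : (v : ℂ) ≠ 0 := Complex.ofReal_ne_zero.2 hv0.ne'
    have h := (hasDerivAt_sub_integral_logSinKernel n t w (inv_pos.2 hv0)).scomp v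
      (hasDerivAt_inv hv0.ne')
    refine (h.const_mul (1 / ((Real.pi : ℂ) * t))).congr_deriv ?_
    have hcpow : ((v⁻¹ : ℝ) : ℂ) ^ (w - 2) = (v : ℂ) ^ (-w) * (v : ℂ) ^ 2 := by
      rw [Complex.ofReal_inv, Complex.inv_cpow _ _ (by
        rw [Complex.arg_ofReal_of_nonneg hv0.le]; exact Real.pi_pos.ne), ← Complex.cpow_neg,
        show -(w - 2) = -w + (2 : ℕ) by push_cast; ring, Complex.cpow_add _ _ hvc,
        Complex.cpow_natCast]
    have htc : (t : ℂ) ≠ 0 := Complex.ofReal_ne_zero.2 ht.ne'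
    have hpi : (Real.pi : ℂ) ≠ 0 := Complex.ofReal_ne_zero.2 Real.pi_ne_zero
    simp only [hf, hcpow, div_eq_mul_inv, Complex.real_smul]
    push_cast
    field_simp
    ring
  have hG1 : G 1 = 0 := by simp [hG]
  rw [intervalIntegral.integral_congr (g := f) fun v hv => by
    simp only [hf, (hasDerivAt_mul_sin_div ht (hpos v hv)).deriv],
    intervalIntegral.integral_eq_sub_of_hasDerivAt hderiv hcont.intervalIntegrable]
  simp only [inv_one, hG1, mul_zero]
  simp only [hG]
  ring

/-- The limit function, expressed through Mellin transforms of `logSin`. -/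
noncomputable def phiLogSin (n : ℕ) (w : ℂ) (t : ℝ) : ℂ :=
  (1 / ((Real.pi : ℂ) * t)) * (((n + 1 : ℕ) : ℂ) * mellin (logSin n t) (w - 1)
    + w * mellin (logSin (n + 1) t) (w - 1))

lemma differentiableOn_phiLogSin (n : ℕ) (t : ℝ) :
    DifferentiableOn ℂ (fun w => phiLogSin n w t) {w : ℂ | w.re < 1} := by
  intro w hw
  have hre : (w - 1).re < 0 := by simpa using hw
  have hM (k : ℕ) : DifferentiableAt ℂ (fun w => mellin (logSin k t) (w - 1)) w :=
    DifferentiableAt.fun_comp' (g := mellin (logSin k t)) w (differentiableAt_mellin_logSin k t hre)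
      (differentiableAt_id.sub_const 1)
  have h := ((hM n).const_mul ((n + 1 : ℕ) : ℂ)).fun_add (differentiableAt_id.fun_mul (hM (n + 1)))
  exact (h.const_mul (1 / ((Real.pi : ℂ) * t))).differentiableWithinAt

lemma exists_norm_phiLogSin_le (n : ℕ) {Ω : Set ℂ} (hΩ : IsCompact Ω)
    (hsub : Ω ⊆ {w : ℂ | w.re < 1}) :
    ∃ C : ℝ, ∀ w ∈ Ω, ∀ t : ℝ, 0 < t → ‖phiLogSin n w t‖ ≤ C / t := by
  rcases Ω.eq_empty_or_nonempty with rfl | hne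
  · exact ⟨0, by simp⟩
  obtain ⟨w₀, hw₀, hmax⟩ := hΩ.exists_isMaxOn hne Complex.continuous_re.continuousOn
  obtain ⟨M, hM⟩ := hΩ.isBounded.exists_norm_le
  have hσ : w₀.re - 1 < 0 := by linarith [show w₀.re < 1 from hsub hw₀]
  obtain ⟨A, hA0, hA⟩ := exists_norm_mellin_logSin_le n hσ
  obtain ⟨B, hB0, hB⟩ := exists_norm_mellin_logSin_le (n + 1) hσ
  refine ⟨(((n + 1 : ℕ) : ℝ) * A + M * B) / Real.pi, fun w hw t ht => ?_⟩
  have hre : (w - 1).re ≤ w₀.re - 1 := by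
    simpa using (hmax hw : w.re ≤ w₀.re)
  have hM0 : 0 ≤ M := (norm_nonneg w).trans (hM w hw)
  calc ‖phiLogSin n w t‖ = 1 / (Real.pi * t) * ‖((n + 1 : ℕ) : ℂ) * mellin (logSin n t) (w - 1)
        + w * mellin (logSin (n + 1) t) (w - 1)‖ := by
        rw [phiLogSin, norm_mul, norm_div, norm_mul, Complex.norm_real, Complex.norm_real,
          norm_one, Real.norm_of_nonneg Real.pi_pos.le, Real.norm_of_nonneg ht.le]
    _ ≤ 1 / (Real.pi * t) * (((n + 1 : ℕ) : ℝ) * A + M * B) := by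
        gcongr
        refine (norm_add_le _ _).trans ?_
        rw [norm_mul, norm_mul, Complex.norm_natCast]
        gcongr
        · exact hA t _ hre
        · exact hM w hw
        · exact hB t _ hre
    _ = (((n + 1 : ℕ) : ℝ) * A + M * B) / Real.pi / t := by
        field_simp

/-- Properties of
`φ_{w,k}(t) = lim_{δ→0⁺} ∫_δ^1 (log(1/v))^k·v^{-w}·(d/dv)[v·sin(2πt/v)/(πt)] dv`
for `k ≥ 1`: the limit exists for `Re w < 1`, `t > 0`, and equals
`lim_{Λ→∞} (1/(πt)) ∫₁^Λ (k + w·log u)·(log u)^{k-1}·u^{w-2}·sin(2πtu) du`;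
`w ↦ φ_{w,k}(t)` is holomorphic on `{Re w < 1}`; and for each compact `Ω ⊆ {Re w < 1}`
there is a uniform `O(1/t)` bound on `[1,∞)`. -/
theorem phi_k_exists_holomorphic_and_bounds (k : ℕ) (hk : 1 ≤ k) :
    ∃ φ : ℂ → ℝ → ℂ,
      (∀ w : ℂ, w.re < 1 → ∀ t : ℝ, 0 < t →
        Filter.Tendsto
            (fun δ : ℝ => ∫ v in δ..1,
              ((Real.log (1/v) : ℝ) : ℂ) ^ k * (v : ℂ) ^ (-w)
                * ((deriv (fun x : ℝ =>
                    x * Real.sin (2 * Real.pi * t / x) / (Real.pi * t)) v : ℝ) : ℂ))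
            (nhdsWithin 0 (Set.Ioi 0)) (nhds (φ w t)) ∧
          Filter.Tendsto
            (fun Λ : ℝ => (1 / ((Real.pi : ℂ) * t))
              * ∫ u in (1:ℝ)..Λ,
                  ((k : ℂ) + w * (Real.log u : ℂ)) * ((Real.log u : ℝ) : ℂ) ^ (k - 1)
                    * (u : ℂ) ^ (w - 2) * (Real.sin (2 * Real.pi * t * u) : ℂ))
            Filter.atTop (nhds (φ w t))) ∧
      (∀ t : ℝ, 0 < t → DifferentiableOn ℂ (fun w => φ w t) {w : ℂ | w.re < 1}) ∧
      (∀ Ω : Set ℂ, IsCompact Ω → Ω ⊆ {w : ℂ | w.re < 1} →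
        ∃ C : ℝ, ∀ w ∈ Ω, ∀ t : ℝ, 1 ≤ t → ‖φ w t‖ ≤ C / t) := by
  obtain ⟨n, rfl⟩ : ∃ n, k = n + 1 := ⟨k - 1, by omega⟩
  refine ⟨phiLogSin n, fun w hw t ht => ?_, fun t _ => differentiableOn_phiLogSin n t,
    fun Ω hΩ hsub => ?_⟩
  · have hlim : Tendsto (fun Λ : ℝ => (1 / ((Real.pi : ℂ) * t))
        * ∫ u in (1 : ℝ)..Λ, logSinKernel n t w u) atTop (nhds (phiLogSin n w t)) :=
      (tendsto_integral_logSinKernel n t hw).const_mul _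
    refine ⟨?_, hlim⟩
    have hbd := (tendsto_log_pow_mul_cpow_mul_sin (n + 1) t hw).const_mul
      (1 / ((Real.pi : ℂ) * t))
    have h := (hlim.sub hbd).comp tendsto_inv_nhdsGT_zero
    rw [mul_zero, sub_zero] at h
    refine h.congr' ?_
    filter_upwards [self_mem_nhdsWithin] with δ hδ
    exact (integral_eq_integral_logSinKernel_sub n ht w hδ).symm
  · obtain ⟨C, hC⟩ := exists_norm_phiLogSin_le n hΩ hsub
    exact ⟨C, fun w hw t ht => hC w hw t (by linarith)⟩
end

section
/- For every integer j ≥ 0 and every nonzero real number a, there is a constant C such that for all 0 < λ < 1: |∫_λ^1 (log(1/t))^j · t^{ia−1} dt| ≤ C·(1 + log(1/λ))^j. -/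
open intervalIntegral

/-- The functions `(log (1/t))^j * t^(ia-1)` have antiderivatives on `(0, ∞)` that are
`O((1 + log (1/t))^j)` on `(0, 1]`. -/
theorem exists_antideriv_log_pow_mul_cpow (j : ℕ) (a : ℝ) (ha : a ≠ 0) :
    ∃ (F : ℝ → ℂ) (C : ℝ), 0 ≤ C ∧
      (∀ t : ℝ, 0 < t → HasDerivAt F (((Real.log (1/t) : ℝ) : ℂ) ^ j
          * (t : ℂ) ^ (Complex.I * (a : ℂ) - 1)) t) ∧
      ∀ t : ℝ, 0 < t → t ≤ 1 → ‖F t‖ ≤ C * (1 + Real.log (1/t)) ^ j := by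
  have hIa : Complex.I * (a : ℂ) ≠ 0 := by simp [ha]
  have hpow (t : ℝ) (ht : 0 < t) :
      HasDerivAt (fun t : ℝ => (t : ℂ) ^ (Complex.I * (a : ℂ)) / (Complex.I * (a : ℂ)))
        ((t : ℂ) ^ (Complex.I * (a : ℂ) - 1)) t := by
    have h := hasDerivAt_ofReal_cpow_const' ht.ne' (r := Complex.I * (a : ℂ) - 1)
      (fun h => hIa (by linear_combination h))
    simpa only [sub_add_cancel] using h
  have hnorm (t : ℝ) (ht : 0 < t) :
      ‖(t : ℂ) ^ (Complex.I * (a : ℂ)) / (Complex.I * (a : ℂ))‖ = 1 / |a| := by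
    rw [norm_div, Complex.norm_cpow_eq_rpow_re_of_pos ht]
    simp
  induction j with
  | zero =>
    refine ⟨fun t => (t : ℂ) ^ (Complex.I * (a : ℂ)) / (Complex.I * (a : ℂ)), 1 / |a|,
      by positivity, fun t ht => ?_, fun t ht _ => ?_⟩
    · simpa only [pow_zero, one_mul] using hpow t ht
    · simpa only [pow_zero, mul_one] using (hnorm t ht).le
  | succ j ih =>
    obtain ⟨F, C, hC, hF, hFC⟩ := ih
    refine ⟨fun t => ((Real.log (1/t) : ℝ) : ℂ) ^ (j + 1)
        * ((t : ℂ) ^ (Complex.I * (a : ℂ)) / (Complex.I * (a : ℂ)))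
        + ((j + 1 : ℂ) / (Complex.I * (a : ℂ))) * F t,
      1 / |a| + (j + 1) / |a| * C, by positivity, fun t ht => ?_, fun t ht ht1 => ?_⟩
    · have hlog : HasDerivAt (fun t : ℝ => ((Real.log (1/t) : ℝ) : ℂ)) ((-t⁻¹ : ℝ) : ℂ) t := by
        simp only [one_div, Real.log_inv]
        exact (Real.hasDerivAt_log ht.ne').neg.ofReal_comp
      refine (((hlog.pow (j + 1)).mul (hpow t ht)).add
        ((hF t ht).const_mul ((j + 1 : ℂ) / (Complex.I * (a : ℂ))))).congr_deriv ?_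
      have ht' : (t : ℂ) ≠ 0 := by exact_mod_cast ht.ne'
      rw [Complex.cpow_sub _ _ ht', Complex.cpow_one]
      simp only [Pi.pow_apply, Nat.add_sub_cancel]
      push_cast
      field_simp
      ring
    · have hL : 0 ≤ Real.log (1/t) := Real.log_nonneg (by rw [le_div_iff₀ ht]; linarith)
      have hcoef : ‖(j + 1 : ℂ) / (Complex.I * (a : ℂ))‖ = (j + 1) / |a| := by
        rw [norm_div, ← Nat.cast_succ, Complex.norm_natCast]
        simp
      have hFt : ‖F t‖ ≤ C * (1 + Real.log (1/t)) ^ (j + 1) :=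
        (hFC t ht ht1).trans (by gcongr <;> linarith)
      calc _ ≤ Real.log (1/t) ^ (j + 1) * (1 / |a|) + (j + 1) / |a| * ‖F t‖ := by
            refine (norm_add_le _ _).trans_eq ?_
            rw [norm_mul, norm_mul, hnorm t ht, hcoef, norm_pow, Complex.norm_real,
              Real.norm_of_nonneg hL]
        _ ≤ (1 + Real.log (1/t)) ^ (j + 1) * (1 / |a|)
            + (j + 1) / |a| * (C * (1 + Real.log (1/t)) ^ (j + 1)) := by
            gcongr
            linarith
        _ = _ := by ring

/-- For each `j ≥ 0` and each nonzero real `a` there is `C` such that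
`|∫_λ^1 (log(1/t))^j t^{ia-1} dt| ≤ C (1 + log(1/λ))^j` for all `0 < λ < 1`. -/
theorem integral_log_pow_mul_cpow_bound (j : ℕ) (a : ℝ) (ha : a ≠ 0) :
    ∃ C : ℝ, ∀ lam : ℝ, 0 < lam → lam < 1 →
      ‖∫ t in lam..1, ((Real.log (1/t) : ℝ) : ℂ) ^ j
          * (t : ℂ) ^ (Complex.I * (a : ℂ) - 1)‖
        ≤ C * (1 + Real.log (1/lam)) ^ j := by
  obtain ⟨F, C, hC, hF, hFC⟩ := exists_antideriv_log_pow_mul_cpow j a ha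
  refine ⟨2 * C, fun lam h0 h1 => ?_⟩
  have hpos (t : ℝ) (ht : t ∈ Set.uIcc lam 1) : 0 < t := by
    rw [Set.uIcc_of_le h1.le] at ht
    exact h0.trans_le ht.1
  have hcont : ContinuousOn (fun t : ℝ => ((Real.log (1/t) : ℝ) : ℂ) ^ j
      * (t : ℂ) ^ (Complex.I * (a : ℂ) - 1)) (Set.uIcc lam 1) := by
    intro t ht
    have ht0 := hpos t ht
    have hlog : ContinuousAt (fun t : ℝ => ((Real.log (1/t) : ℝ) : ℂ)) t := by
      simp only [one_div, Real.log_inv]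
      exact Complex.continuous_ofReal.continuousAt.comp (Real.continuousAt_log ht0.ne').neg
    exact ((hlog.pow j).mul
      (Complex.continuousAt_ofReal_cpow_const t _ (Or.inr ht0.ne'))).continuousWithinAt
  rw [integral_eq_sub_of_hasDerivAt (fun t ht => hF t (hpos t ht)) hcont.intervalIntegrable]
  have hL : 0 ≤ Real.log (1/lam) := Real.log_nonneg (by rw [le_div_iff₀ h0]; linarith)
  have hone : 1 ≤ (1 + Real.log (1/lam)) ^ j := one_le_pow₀ (by linarith)
  have hF1 : ‖F 1‖ ≤ C := by simpa using hFC 1 one_pos le_rfl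
  calc _ ≤ ‖F 1‖ + ‖F lam‖ := norm_sub_le _ _
    _ ≤ C * (1 + Real.log (1/lam)) ^ j + C * (1 + Real.log (1/lam)) ^ j :=
        add_le_add (hF1.trans (le_mul_of_one_le_right hC hone)) (hFC lam h0 h1.le)
    _ = _ := by ring
end

section
/- For every integer m ≥ 1, the m×m Cauchy (Hilbert) matrix H with entries H_{ij} = 1/(i+j+1) for 0 ≤ i,j < m is invertible, and the top-left entry of its inverse equals m²: (H⁻¹)_{00} = m². -/
/-- The Cauchy matrix `1 / (xᵢ - yⱼ)` has an explicit right inverse, obtained from the barycentric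
form of the Lagrange basis polynomials at the nodes `xₖ` interpolated at the nodes `yⱼ`. -/
theorem cauchyMatrix_mul_lagrange {ι F : Type*} [Fintype ι] [DecidableEq ι] [Field F]
    {x y : ι → F} (hx : Function.Injective x) (hy : Function.Injective y)
    (hxy : ∀ i j, x i ≠ y j) :
    (Matrix.of fun i j => 1 / (x i - y j)) *
      (Matrix.of fun j k => Lagrange.nodalWeight Finset.univ y j *
        (Lagrange.basis Finset.univ x k).eval (y j) *
          (Lagrange.nodal Finset.univ y).eval (x k)) = 1 := by
  ext i k
  have hdeg : (Lagrange.basis Finset.univ x k).degree < (Finset.univ : Finset ι).card := by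
    rw [Lagrange.degree_basis hx.injOn (Finset.mem_univ k)]
    exact_mod_cast Nat.sub_lt (Finset.card_pos.mpr ⟨k, Finset.mem_univ k⟩) one_pos
  have hbary : (Lagrange.basis Finset.univ x k).eval (x i) =
      (Lagrange.nodal Finset.univ y).eval (x i) * ∑ j, Lagrange.nodalWeight Finset.univ y j *
        (x i - y j)⁻¹ * (Lagrange.basis Finset.univ x k).eval (y j) := by
    rw [← Lagrange.eval_interpolate_not_at_node _ fun j _ => hxy i j,
      ← Lagrange.eq_interpolate hy.injOn hdeg]
  have hnodal : (Lagrange.nodal Finset.univ y).eval (x i) ≠ 0 :=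
    Lagrange.eval_nodal_not_at_node fun j _ => hxy i j
  have hsum : (∑ j, 1 / (x i - y j) * (Lagrange.nodalWeight Finset.univ y j *
        (Lagrange.basis Finset.univ x k).eval (y j) *
          (Lagrange.nodal Finset.univ y).eval (x k))) =
      (∑ j, Lagrange.nodalWeight Finset.univ y j * (x i - y j)⁻¹ *
        (Lagrange.basis Finset.univ x k).eval (y j)) *
          (Lagrange.nodal Finset.univ y).eval (x k) := by
    rw [Finset.sum_mul]
    exact Finset.sum_congr rfl fun j _ => by ring
  simp only [Matrix.mul_apply, Matrix.of_apply]
  rw [hsum]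
  rcases eq_or_ne i k with rfl | hik
  · rw [Lagrange.eval_basis_self hx.injOn (Finset.mem_univ i)] at hbary
    rw [Matrix.one_apply_eq, mul_comm, ← hbary]
  · rw [Lagrange.eval_basis_of_ne hik.symm (Finset.mem_univ i)] at hbary
    rw [Matrix.one_apply_ne hik, (mul_eq_zero.mp hbary.symm).resolve_left hnodal, zero_mul]

theorem Fin.prod_univ_erase_zero {M : Type*} [CommMonoid M] {n : ℕ} (f : Fin (n + 1) → M) :
    ∏ i ∈ Finset.univ.erase 0, f i = ∏ i : Fin n, f i.succ := by
  rw [Fin.univ_succ, Finset.erase_cons, Finset.prod_map]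
  rfl

theorem prod_range_hilbert_telescope (n : ℕ) :
    (∏ i ∈ Finset.range n, ((i : ℚ) + 1)⁻¹) *
      (∏ i ∈ Finset.range n, ((i : ℚ) + 2) / (i + 1)) *
        ∏ i ∈ Finset.range (n + 1), ((i : ℚ) + 1) = ((n : ℚ) + 1) ^ 2 := by
  induction n with
  | zero => simp
  | succ n ih =>
    rw [Finset.prod_range_succ, Finset.prod_range_succ, Finset.prod_range_succ _ (n + 1)]
    have h : (n : ℚ) + 1 ≠ 0 := by positivity
    push_cast
    calc _ = ((∏ i ∈ Finset.range n, ((i : ℚ) + 1)⁻¹) *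
          (∏ i ∈ Finset.range n, ((i : ℚ) + 2) / (i + 1)) *
            ∏ i ∈ Finset.range (n + 1), ((i : ℚ) + 1)) *
              (((n : ℚ) + 1)⁻¹ * (((n : ℚ) + 2) / (n + 1)) * (n + 1 + 1)) := by ring
      _ = _ := by
        rw [ih]
        field_simp
        ring

/-- The `m×m` Cauchy (Hilbert) matrix `H_{ij} = 1/(i+j+1)`, `0 ≤ i,j < m`, is invertible
and the top-left entry of its inverse equals `m²`. -/
theorem hilbertMatrix_invertible_and_inv_topLeft (m : ℕ) (hm : 1 ≤ m) :
    IsUnit (Matrix.of fun i j : Fin m => (1 : ℚ) / ((i : ℕ) + (j : ℕ) + 1)).det ∧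
      (Matrix.of fun i j : Fin m => (1 : ℚ) / ((i : ℕ) + (j : ℕ) + 1))⁻¹
          ⟨0, hm⟩ ⟨0, hm⟩ = (m : ℚ) ^ 2 := by
  obtain ⟨n, rfl⟩ : ∃ n, m = n + 1 := ⟨m - 1, by omega⟩
  have hx : Function.Injective fun i : Fin (n + 1) => ((i : ℕ) : ℚ) :=
    Nat.cast_injective.comp Fin.val_injective
  have hy : Function.Injective fun j : Fin (n + 1) => -(((j : ℕ) : ℚ) + 1) :=
    neg_injective.comp ((add_left_injective 1).comp hx)
  have hxy (i j : Fin (n + 1)) : ((i : ℕ) : ℚ) ≠ -(((j : ℕ) : ℚ) + 1) := by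
    have : (0 : ℚ) < (i : ℕ) + ((j : ℕ) + 1) := by positivity
    intro h
    linarith
  have hmul := cauchyMatrix_mul_lagrange hx hy hxy
  simp only [sub_neg_eq_add, ← add_assoc] at hmul
  refine ⟨Matrix.isUnit_det_of_right_inverse hmul, ?_⟩
  rw [Matrix.inv_eq_right_inv hmul, Matrix.of_apply, Fin.mk_zero', Lagrange.nodalWeight,
    Lagrange.basis, Polynomial.eval_prod, Lagrange.eval_nodal, Fin.prod_univ_erase_zero,
    Fin.prod_univ_erase_zero]
  push_cast
  rw [← prod_range_hilbert_telescope, ← Fin.prod_univ_eq_prod_range, ← Fin.prod_univ_eq_prod_range,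
    ← Fin.prod_univ_eq_prod_range]
  congr 1
  · congr 1
    · refine Finset.prod_congr rfl fun i _ => ?_
      simp
    · refine Finset.prod_congr rfl fun i _ => ?_
      simp only [Lagrange.basisDivisor, Polynomial.eval_mul, Polynomial.eval_sub,
        Polynomial.eval_C, Polynomial.eval_X, Fin.val_zero, Fin.val_succ, Nat.cast_add,
        Nat.cast_zero, Nat.cast_one, zero_sub, zero_add, inv_neg]
      ring
  · simp
end
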